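/- arXiv:1811.06739 — 5 statements merged into one kernel-verified Lean document; each statement's English description precedes it below -/
import Mathlib

section
/- For all integers m > k ≥ 1 and every real number q with 0 < q < 1, the plurality rule satisfies the (q,k,m)-majority criterion if and only if q ≥ k/(k+1). -/
open Finset
open scoped Classical

noncomputable section

/-- A preference profile: each of the `n` voters has a ranking of the `m`
candidates, given as a bijection sending each candidate to its rank
(rank `0` is the best).  Voter `i` prefers `a` to `b` iff `P i a < P i b`. -/
abbrev Profile (m n : ℕ) := Fin n → (Fin m ≃ Fin m)

namespace Voting

variable {m n : ℕ}

/-- `h(a,b)`: the number of voters who prefer candidate `a` to candidate `b`. -/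
def pairs (P : Profile m n) (a b : Fin m) : ℕ :=
  (Finset.univ.filter fun i => P i a < P i b).card

/-- `n_1(a)`: the number of voters who rank candidate `a` first. -/
def firstCount (P : Profile m n) (a : Fin m) : ℕ :=
  (Finset.univ.filter fun i => ∀ b, b ≠ a → P i a < P i b).card

/-- `n_m(a)`: the number of voters who rank candidate `a` last. -/
def lastCount (P : Profile m n) (a : Fin m) : ℕ :=
  (Finset.univ.filter fun i => ∀ b, b ≠ a → P i b < P i a).card

/-- The number of voters who give the set `B` the top `|B|` positions. -/
def topSupporters (P : Profile m n) (B : Finset (Fin m)) : ℕ :=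
  (Finset.univ.filter fun i => ∀ a ∈ B, ∀ b ∉ B, P i a < P i b).card

/-- The `(q,k,m)`-majority criterion for a voting rule with `m` candidates:
for every number of voters `n ≥ 1`, every profile, and every `k`-element set `B`
of candidates such that strictly more than `q·n` voters give `B` the top `k`
positions, every winner belongs to `B`. -/
def MajorityCriterion (m k : ℕ) (q : ℝ)
    (rule : (n : ℕ) → Profile m n → Finset (Fin m)) : Prop :=
  ∀ n : ℕ, 1 ≤ n → ∀ P : Profile m n, ∀ B : Finset (Fin m),
    B.card = k → q * (n : ℝ) < (topSupporters P B : ℝ) → rule n P ⊆ B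

/-- The plurality rule: the winners are the candidates maximizing `n_1`. -/
def pluralityWinners (P : Profile m n) : Finset (Fin m) :=
  Finset.univ.filter fun a => ∀ b, firstCount P b ≤ firstCount P a

lemma topSupporters_le_sum_firstCount (P : Profile m n) {B : Finset (Fin m)} (hB : B.Nonempty) :
    topSupporters P B ≤ ∑ b ∈ B, firstCount P b := by
  refine (Finset.card_le_card fun i hi => ?_).trans Finset.card_biUnion_le
  obtain ⟨b, hb, hmin⟩ := B.exists_min_image (P i) hB
  refine Finset.mem_biUnion.2 ⟨b, hb, Finset.mem_filter.2 ⟨Finset.mem_univ _, fun c hc => ?_⟩⟩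
  by_cases hcB : c ∈ B
  · exact (hmin c hcB).lt_of_ne fun h => hc ((P i).injective h).symm
  · exact (Finset.mem_filter.1 hi).2 b hb c hcB

lemma firstCount_add_topSupporters_le (P : Profile m n) {B : Finset (Fin m)} (hB : B.Nonempty)
    {a : Fin m} (ha : a ∉ B) : firstCount P a + topSupporters P B ≤ n := by
  unfold firstCount topSupporters
  rw [← Finset.card_union_of_disjoint]
  · exact (Finset.card_le_univ _).trans_eq (Fintype.card_fin n)
  · refine Finset.disjoint_left.2 fun i hia hiB => ?_
    obtain ⟨b, hb⟩ := hB
    exact lt_asymm ((Finset.mem_filter.1 hia).2 b (ne_of_mem_of_not_mem hb ha))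
      ((Finset.mem_filter.1 hiB).2 b hb a ha)

/-- If a plurality winner lies outside `B`, then at most `n * |B| / (|B| + 1)` voters give `B`
the top positions. -/
lemma topSupporters_mul_le_of_winner_notMem (P : Profile m n) {B : Finset (Fin m)}
    (hB : B.Nonempty) {a : Fin m} (ha : a ∉ B) (hwin : a ∈ pluralityWinners P) :
    topSupporters P B * (B.card + 1) ≤ B.card * n := by
  have hsum : topSupporters P B ≤ B.card * firstCount P a :=
    (topSupporters_le_sum_firstCount P hB).trans
      (Finset.sum_le_card_nsmul B _ _ fun b _ => (Finset.mem_filter.1 hwin).2 b)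
  nlinarith [firstCount_add_topSupporters_le P hB ha]

/-- The profile with `k + 1` voters in which voter `i` ranks candidate `i` first, obtained from the
identity ranking by exchanging the candidates `0` and `i`. -/
def swapProfile {k : ℕ} (hkm : k + 1 ≤ m) : Profile m (k + 1) := fun i =>
  Equiv.swap (Fin.castLE hkm 0) (Fin.castLE hkm i)

lemma firstCount_swapProfile_le_one {k : ℕ} (hkm : k + 1 ≤ m) (b : Fin m) :
    firstCount (swapProfile hkm) b ≤ 1 := by
  have top : ∀ i, (∀ c, c ≠ b → swapProfile hkm i b < swapProfile hkm i c) →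
      Fin.castLE hkm i = b := by
    intro i hi
    by_contra hne
    have h := hi _ hne
    simp [swapProfile, Fin.lt_def] at h
  refine Finset.card_le_one.2 fun i hi j hj => ?_
  exact Fin.castLE_injective hkm ((top i (Finset.mem_filter.1 hi).2).trans
    (top j (Finset.mem_filter.1 hj).2).symm)

lemma last_mem_pluralityWinners_swapProfile {k : ℕ} (hkm : k + 1 ≤ m) :
    Fin.castLE hkm (Fin.last k) ∈ pluralityWinners (swapProfile hkm) := by
  refine Finset.mem_filter.2 ⟨Finset.mem_univ _, fun b =>
    (firstCount_swapProfile_le_one hkm b).trans (Finset.card_pos.2 ⟨Fin.last k, ?_⟩)⟩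
  refine Finset.mem_filter.2 ⟨Finset.mem_univ _, fun c hc => ?_⟩
  have hne : swapProfile hkm (Fin.last k) c ≠ Fin.castLE hkm 0 := by
    intro h
    exact hc ((swapProfile hkm (Fin.last k)).injective (h.trans (by simp [swapProfile])))
  rw [swapProfile, Equiv.swap_apply_right, ← swapProfile, Fin.lt_def]
  exact Nat.pos_of_ne_zero fun h => hne (Fin.ext h)

lemma le_topSupporters_swapProfile {k : ℕ} (hkm : k + 1 ≤ m) :
    k ≤ topSupporters (swapProfile hkm) (Finset.univ.filter fun c : Fin m => c.val < k) := by
  have himage : ((Finset.univ : Finset (Fin k)).image Fin.castSucc).card = k := by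
    rw [Finset.card_image_of_injective _ (Fin.castSucc_injective k), Finset.card_fin]
  refine himage.symm.le.trans (Finset.card_le_card fun i hi => ?_)
  obtain ⟨j, -, rfl⟩ := Finset.mem_image.1 hi
  refine Finset.mem_filter.2 ⟨Finset.mem_univ _, fun a ha b hb => ?_⟩
  simp only [Finset.mem_filter, Finset.mem_univ, true_and, not_lt] at ha hb
  have hj := j.isLt
  simp only [swapProfile, Equiv.swap_apply_def, Fin.lt_def, Fin.ext_iff, Fin.val_castLE,
    Fin.val_castSucc, Fin.val_zero]
  split_ifs <;> simp <;> omega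

/-- For all integers `m > k ≥ 1` and every real `q` with `0 < q < 1`, the
plurality rule satisfies the `(q,k,m)`-majority criterion iff `q ≥ k/(k+1)`. -/
theorem plurality_qkm_majority (m k : ℕ) (hk : 1 ≤ k) (hmk : k < m)
    (q : ℝ) (hq0 : 0 < q) (hq1 : q < 1) :
    MajorityCriterion m k q (fun n P => pluralityWinners P) ↔
      (k : ℝ) / ((k : ℝ) + 1) ≤ q := by
  constructor
  · intro h
    by_contra! hq
    have hk0 : (0 : ℝ) < (k : ℝ) + 1 := by positivity
    have hle : (k : ℝ) ≤ topSupporters (swapProfile hmk)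
        (Finset.univ.filter fun c : Fin m => c.val < k) := by
      exact_mod_cast le_topSupporters_swapProfile hmk
    have hmem := h (k + 1) (by omega) (swapProfile hmk)
      (Finset.univ.filter fun c : Fin m => c.val < k) (by simp [Fin.card_filter_val_lt, hmk.le])
      (by push_cast; exact ((lt_div_iff₀ hk0).1 hq).trans_le hle)
      (last_mem_pluralityWinners_swapProfile hmk)
    simp at hmem
  · intro hq n _ P B hB hT a hwin
    by_contra ha
    have hle := topSupporters_mul_le_of_winner_notMem P (Finset.card_pos.1 (by omega)) ha hwin
    rw [hB] at hle
    have hle' : (topSupporters P B : ℝ) * (k + 1) ≤ k * n := by exact_mod_cast hle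
    have hk0 : (0 : ℝ) < (k : ℝ) + 1 := by positivity
    have hkq : (k : ℝ) ≤ q * (k + 1) := (div_le_iff₀ hk0).1 hq
    nlinarith [mul_lt_mul_of_pos_right hT hk0, mul_le_mul_of_nonneg_right hkq n.cast_nonneg]

end Voting
end
end

section
/- For all integers m > k > 1 and every real number q with 0 < q < 1, Simpson's rule satisfies the (q,k,m)-majority criterion if and only if q ≥ (k−1)/k. -/
open Finset
open scoped Classical

noncomputable section

namespace Voting

variable {m n : ℕ}

/-- Simpson's (maximin) score: `Si(a) = min_{b ≠ a} h(a,b)`. -/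
def simpsonScore (P : Profile m n) (a : Fin m) : ℕ :=
  sInf {x : ℕ | ∃ b, b ≠ a ∧ pairs P a b = x}

/-- Simpson's rule: the winners are the candidates with the highest score. -/
def simpsonWinners (P : Profile m n) : Finset (Fin m) :=
  Finset.univ.filter fun a => ∀ b, simpsonScore P b ≤ simpsonScore P a

theorem simpsonScore_le_pairs (P : Profile m n) {a b : Fin m} (hba : b ≠ a) :
    simpsonScore P a ≤ pairs P a b :=
  Nat.sInf_le ⟨b, hba, rfl⟩

theorem exists_pairs_eq_simpsonScore (hm : 1 < m) (P : Profile m n) (a : Fin m) :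
    ∃ b, b ≠ a ∧ pairs P a b = simpsonScore P a := by
  have : Nontrivial (Fin m) := Fin.nontrivial_iff_two_le.2 hm
  obtain ⟨b, hb⟩ := exists_ne a
  exact Nat.sInf_mem (s := {x : ℕ | ∃ b, b ≠ a ∧ pairs P a b = x}) ⟨_, b, hb, rfl⟩

theorem pairs_add_topSupporters_le (P : Profile m n) {B : Finset (Fin m)} {b c : Fin m}
    (hb : b ∈ B) (hc : c ∉ B) : pairs P c b + topSupporters P B ≤ n := by
  unfold pairs topSupporters
  rw [← Finset.card_union_of_disjoint]
  · exact (Finset.card_le_univ _).trans_eq (Fintype.card_fin n)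
  · rw [Finset.disjoint_left]
    intro i hi hi'
    simp only [Finset.mem_filter, Finset.mem_univ, true_and] at hi hi'
    exact lt_asymm hi (hi' b hb c hc)

theorem topSupporters_le_pairs (P : Profile m n) {B : Finset (Fin m)} {b c : Fin m}
    (hb : b ∈ B) (hc : c ∉ B) : topSupporters P B ≤ pairs P b c := by
  apply Finset.card_le_card
  intro i hi
  simp only [Finset.mem_filter, Finset.mem_univ, true_and] at hi ⊢
  exact hi b hb c hc

/-- Some member of `B` is the favourite within `B` of at least `n / |B|` voters. -/
theorem exists_card_mul_pairs_ge (P : Profile m n) {B : Finset (Fin m)} (hB : B.Nonempty) :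
    ∃ b ∈ B, ∀ a ∈ B, a ≠ b → (n : ℝ) ≤ B.card * (pairs P b a : ℝ) := by
  choose f hfB hf using fun i => Finset.exists_min_image B (P i) hB
  have hpos : (0 : ℝ) < B.card := by exact_mod_cast hB.card_pos
  obtain ⟨b, hb, hcard⟩ := Finset.exists_le_card_fiber_of_nsmul_le_card_of_maps_to
    (s := (Finset.univ : Finset (Fin n))) (t := B) (f := f) (b := (n : ℝ) / B.card)
    (fun i _ => hfB i) hB (by simp [mul_div_cancel₀ _ hpos.ne'])
  refine ⟨b, hb, fun a ha hab => ?_⟩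
  rw [div_le_iff₀' hpos] at hcard
  refine hcard.trans ?_
  gcongr
  refine Finset.card_le_card fun i hi => ?_
  simp only [Finset.mem_filter, Finset.mem_univ, true_and] at hi ⊢
  subst hi
  exact lt_of_le_of_ne (hf i a ha) fun h => hab ((P i).injective h).symm

theorem simpsonWinners_subset (P : Profile m n) {B : Finset (Fin m)} (hB : 1 < B.card)
    (hm : B.card < m)
    (ht : ((B.card : ℝ) - 1) * n < B.card * (topSupporters P B : ℝ)) :
    simpsonWinners P ⊆ B := by
  intro c hc
  by_contra hcB
  simp only [simpsonWinners, Finset.mem_filter, Finset.mem_univ, true_and] at hc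
  obtain ⟨b, hb, hbB⟩ := exists_card_mul_pairs_ge P (Finset.card_pos.1 (zero_lt_one.trans hB))
  obtain ⟨a, hab, ha⟩ := exists_pairs_eq_simpsonScore (by lia) P b
  have hbc : b ≠ c := fun h => hcB (h ▸ hb)
  have hle := (hc b).trans (simpsonScore_le_pairs P hbc)
  rw [← ha] at hle
  have hsum := pairs_add_topSupporters_le P hb hcB
  have hsum' : (pairs P b a : ℝ) + topSupporters P B ≤ n := by exact_mod_cast (by lia)
  have hk : (2 : ℝ) ≤ B.card := by exact_mod_cast hB
  by_cases haB : a ∈ B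
  · have := hbB a haB hab
    nlinarith
  · have h : (topSupporters P B : ℝ) ≤ pairs P b a := by
      exact_mod_cast topSupporters_le_pairs P hb haB
    have hn : (0 : ℝ) ≤ n := Nat.cast_nonneg n
    nlinarith

/-- The rank of candidate `x` for voter `i` in a profile where voter `0` puts candidate `k` on top,
and every other voter puts the candidates below `k` on top, cyclically shifted by `i`. -/
def cyclicRank (k i x : ℕ) : ℕ :=
  if x < k then (if i = 0 then x + 1 else if x + i < k then x + i else x + i - k)
  else if x = k then (if i = 0 then 0 else k) else x

theorem cyclicRank_lt {k i x m : ℕ} (hkm : k < m) (hi : i < k) (hx : x < m) :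
    cyclicRank k i x < m := by
  unfold cyclicRank; split_ifs <;> lia

theorem cyclicRank_injective {k i x y : ℕ} (hi : i < k)
    (h : cyclicRank k i x = cyclicRank k i y) : x = y := by
  unfold cyclicRank at h; split_ifs at h <;> lia

/-- The profile with `k` voters whose rankings are given by `cyclicRank`. -/
def cyclicProfile {m k : ℕ} (hkm : k < m) : Profile m k := fun i =>
  Equiv.ofBijective (fun x : Fin m => (⟨cyclicRank k i x, cyclicRank_lt hkm i.2 x.2⟩ : Fin m))
    (Finite.injective_iff_bijective.1 fun _ _ h =>
      Fin.ext (cyclicRank_injective i.2 (Fin.mk.inj h)))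

theorem cyclicProfile_lt_iff {m k : ℕ} (hkm : k < m) (i : Fin k) (x y : Fin m) :
    cyclicProfile hkm i x < cyclicProfile hkm i y ↔ cyclicRank k i x < cyclicRank k i y :=
  Iff.rfl

theorem le_topSupporters_cyclicProfile {m k : ℕ} (hkm : k < m) :
    k - 1 ≤ topSupporters (cyclicProfile hkm) (Finset.univ.filter fun x => x.1 < k) := by
  rcases Nat.eq_zero_or_pos k with rfl | hk
  · simp
  calc k - 1 = ((Finset.univ : Finset (Fin k)).erase ⟨0, hk⟩).card := by simp
    _ ≤ _ := by
      refine Finset.card_le_card fun i hi => ?_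
      simp only [Finset.mem_erase, Finset.mem_filter, Finset.mem_univ, true_and, and_true,
        ne_eq, Fin.ext_iff] at hi ⊢
      intro a ha b hb
      rw [cyclicProfile_lt_iff]
      have := i.2
      unfold cyclicRank; split_ifs <;> lia

theorem one_le_simpsonScore_cyclicProfile {m k : ℕ} (hk : 1 < k) (hkm : k < m) :
    1 ≤ simpsonScore (cyclicProfile hkm) ⟨k, hkm⟩ := by
  obtain ⟨b, hb, h⟩ := exists_pairs_eq_simpsonScore (by lia) (cyclicProfile hkm) ⟨k, hkm⟩
  rw [← h]
  refine Finset.card_pos.2 ⟨⟨0, by lia⟩, ?_⟩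
  simp only [Finset.mem_filter, Finset.mem_univ, true_and, cyclicProfile_lt_iff]
  rw [ne_eq, Fin.ext_iff] at hb
  simp only at hb
  unfold cyclicRank; split_ifs <;> lia

theorem simpsonScore_cyclicProfile_le_one {m k : ℕ} (hk : 1 < k) (hkm : k < m) (a : Fin m)
    (ha : a.1 ≠ k) : simpsonScore (cyclicProfile hkm) a ≤ 1 := by
  have hlt : (if a.1 < k then (if a.1 = 0 then k - 1 else a.1 - 1) else k) < m := by
    split_ifs <;> lia
  obtain ⟨b, hb⟩ : ∃ b : Fin m, b.1 =
      if a.1 < k then (if a.1 = 0 then k - 1 else a.1 - 1) else k :=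
    ⟨⟨_, hlt⟩, rfl⟩
  have hba : b ≠ a := by
    rw [ne_eq, Fin.ext_iff, hb]; split_ifs <;> lia
  refine (simpsonScore_le_pairs _ hba).trans (Finset.card_le_one.2 ?_)
  intro i hi j hj
  simp only [Finset.mem_filter, Finset.mem_univ, true_and, cyclicProfile_lt_iff] at hi hj
  have hi' := i.2
  have hj' := j.2
  have key : ∀ i : ℕ, i < k → cyclicRank k i a < cyclicRank k i b →
      a.1 < k ∧ (i + a.1 = k ∨ (i = 0 ∧ a.1 = 0)) := by
    intro i hi h
    unfold cyclicRank at h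
    rw [hb] at h
    split_ifs at h <;> lia
  have hi2 := key i hi' hi
  have hj2 := key j hj' hj
  apply Fin.ext
  lia

/-- For all integers `m > k > 1` and every real `q` with `0 < q < 1`, Simpson's
rule satisfies the `(q,k,m)`-majority criterion iff `q ≥ (k−1)/k`. -/
theorem simpson_qkm_majority (m k : ℕ) (hk : 1 < k) (hmk : k < m)
    (q : ℝ) (hq0 : 0 < q) (hq1 : q < 1) :
    MajorityCriterion m k q (fun n P => simpsonWinners P) ↔
      ((k : ℝ) - 1) / (k : ℝ) ≤ q := by
  have hk0 : (0 : ℝ) < k := by exact_mod_cast (by lia : 0 < k)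
  constructor
  · intro h
    by_contra! hq
    rw [lt_div_iff₀ hk0] at hq
    have hsup : (k : ℝ) - 1 ≤
        topSupporters (cyclicProfile hmk) (Finset.univ.filter fun x => x.1 < k) := by
      have := le_topSupporters_cyclicProfile hmk
      rw [sub_le_iff_le_add]
      exact_mod_cast (by lia)
    have hsub := h k hk.le (cyclicProfile hmk) (Finset.univ.filter fun x => x.1 < k)
      (by simp [Fin.card_filter_val_lt, hmk.le]) (hq.trans_le hsup)
    have hwin : (⟨k, hmk⟩ : Fin m) ∈ simpsonWinners (cyclicProfile hmk) := by
      simp only [simpsonWinners, Finset.mem_filter, Finset.mem_univ, true_and]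
      intro b
      by_cases hb : b.1 = k
      · rw [show b = ⟨k, hmk⟩ from Fin.ext hb]
      · exact (simpsonScore_cyclicProfile_le_one hk hmk b hb).trans
          (one_le_simpsonScore_cyclicProfile hk hmk)
    simpa using hsub hwin
  · rintro hq n - P B rfl ht
    refine simpsonWinners_subset P hk hmk ?_
    rw [div_le_iff₀ hk0] at hq
    have hn : (0 : ℝ) ≤ n := Nat.cast_nonneg n
    nlinarith

end Voting
end
end

section
/- For all integers k ≥ 1 and m = k+1, and every real number q with 0 < q < 1, the convex median voting rule satisfies the (q,k,m)-majority criterion if and only if q ≥ 1/2. -/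
open Finset
open scoped Classical

noncomputable section

namespace Voting

variable {m n : ℕ}

/-- The number of voters giving candidate `a` rank `j` (0-indexed);
it is `0` for `j ≥ m`. -/
def rankCountNat (P : Profile m n) (a : Fin m) (j : ℕ) : ℕ :=
  (Finset.univ.filter fun i => ((P i a : Fin m) : ℕ) = j).card

/-- The truncated Borda score
`B_t(a) = t·n_1(a) + (t−1)·n_2(a) + … + (t−⌊t⌋)·n_{⌊t⌋+1}(a)`. -/
def truncBorda (P : Profile m n) (a : Fin m) (t : ℝ) : ℝ :=
  ∑ j ∈ Finset.range (⌊t⌋₊ + 1), (t - (j : ℝ)) * (rankCountNat P a j : ℝ)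

/-- The convex-median score `CM(a) = max{t ≥ 1 : B_t(a)/t ≤ n/2}`. -/
def cmScore (P : Profile m n) (a : Fin m) : ℝ :=
  sSup {t : ℝ | 1 ≤ t ∧ truncBorda P a t / t ≤ (n : ℝ) / 2}

/-- The convex median voting rule: a candidate with `n_1(a) > n/2` (if any) is
the unique winner; otherwise the winners are the candidates with the lowest
value of the convex median. -/
def cmWinners (P : Profile m n) : Finset (Fin m) :=
  if ∃ a : Fin m, (n : ℝ) / 2 < (firstCount P a : ℝ) then
    Finset.univ.filter fun a => (n : ℝ) / 2 < (firstCount P a : ℝ)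
  else
    Finset.univ.filter fun a => ∀ b, cmScore P a ≤ cmScore P b

/-- The sum over all voters of the (0-indexed) rank of candidate `a`. -/
def rankSum {m n : ℕ} (P : Profile m n) (a : Fin m) : ℕ :=
  ∑ i, (P i a : ℕ)

lemma truncBorda_eq_of_le {k n : ℕ} (P : Profile (k + 1) n) (a : Fin (k + 1)) {t : ℝ}
    (ht : (k : ℝ) ≤ t) : truncBorda P a t = t * n - rankSum P a := by
  have hk : k ≤ ⌊t⌋₊ := Nat.le_floor ht
  have key : ∀ j : ℕ, (t - (j : ℝ)) * (rankCountNat P a j : ℝ)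
      = ∑ i : Fin n, if (P i a : ℕ) = j then t - (j : ℝ) else 0 := by
    intro j
    rw [← Finset.sum_filter, Finset.sum_const, nsmul_eq_mul, mul_comm]
    rfl
  unfold truncBorda rankSum
  simp_rw [key]
  rw [Finset.sum_comm]
  have hi : ∀ i : Fin n, (∑ j ∈ Finset.range (⌊t⌋₊ + 1),
      if (P i a : ℕ) = j then t - (j : ℝ) else 0) = t - (P i a : ℕ) := by
    intro i
    rw [Finset.sum_ite_eq, if_pos]
    have := (P i a).isLt
    rw [Finset.mem_range]
    omega
  simp_rw [hi]
  simp [Finset.sum_sub_distrib, mul_comm]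

lemma truncBorda_div_le_iff {k n : ℕ} (hk : 1 ≤ k) (P : Profile (k + 1) n) (a : Fin (k + 1))
    {t : ℝ} (ht : (k : ℝ) ≤ t) :
    truncBorda P a t / t ≤ (n : ℝ) / 2 ↔ t * n ≤ 2 * rankSum P a := by
  have h1 : (1 : ℝ) ≤ k := by exact_mod_cast hk
  rw [truncBorda_eq_of_le P a ht, div_le_iff₀ (by linarith)]
  constructor <;> intro h <;> linarith

lemma cmScore_eq_of_le {k n : ℕ} (hk : 1 ≤ k) (hn : 1 ≤ n) (P : Profile (k + 1) n)
    (a : Fin (k + 1)) (h : k * n ≤ 2 * rankSum P a) :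
    cmScore P a = 2 * rankSum P a / n := by
  have h1 : (1 : ℝ) ≤ k := by exact_mod_cast hk
  have hn0 : (0 : ℝ) < n := by exact_mod_cast hn
  have h' : (k : ℝ) * n ≤ 2 * rankSum P a := by exact_mod_cast h
  have hkt : (k : ℝ) ≤ 2 * rankSum P a / n := by rwa [le_div_iff₀ hn0]
  refine IsGreatest.csSup_eq ⟨⟨h1.trans hkt, ?_⟩, ?_⟩
  · rw [truncBorda_div_le_iff hk P a hkt, div_mul_cancel₀ _ hn0.ne']
  · rintro t ⟨-, ht⟩
    rcases le_total t k with htk | htk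
    · exact htk.trans hkt
    · rwa [truncBorda_div_le_iff hk P a htk, ← le_div_iff₀ hn0] at ht

lemma lt_rankSum_of_lt_cmScore {k n : ℕ} (hk : 1 ≤ k) (hn : 1 ≤ n) (P : Profile (k + 1) n)
    (a : Fin (k + 1)) (h : (k : ℝ) < cmScore P a) : k * n < 2 * rankSum P a := by
  have hn0 : (0 : ℝ) < n := by exact_mod_cast hn
  have hne : {t : ℝ | 1 ≤ t ∧ truncBorda P a t / t ≤ (n : ℝ) / 2}.Nonempty := by
    by_contra hne
    rw [Set.not_nonempty_iff_eq_empty] at hne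
    rw [cmScore, hne, Real.sSup_empty] at h
    exact absurd h (not_lt.mpr k.cast_nonneg)
  obtain ⟨t, ⟨-, ht⟩, hkt⟩ := exists_lt_of_lt_csSup hne h
  rw [truncBorda_div_le_iff hk P a hkt.le] at ht
  have : (k : ℝ) * n < 2 * rankSum P a := (mul_lt_mul_of_pos_right hkt hn0).trans_le ht
  exact_mod_cast this

lemma sum_rankSum_mul_two {k n : ℕ} (P : Profile (k + 1) n) :
    (∑ a, rankSum P a) * 2 = n * ((k + 1) * k) := by
  unfold rankSum
  rw [Finset.sum_comm]
  have hi : ∀ i : Fin n, ∑ a, (P i a : ℕ) = ∑ j ∈ Finset.range (k + 1), j := fun i => by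
    rw [Equiv.sum_comp (P i) (fun j : Fin (k + 1) => (j : ℕ)),
      Fin.sum_univ_eq_sum_range (fun j => j)]
  simp_rw [hi]
  rw [Finset.sum_const, smul_eq_mul, mul_assoc, Finset.sum_range_id_mul_two]
  simp

lemma topSupporters_compl_singleton {m n : ℕ} (P : Profile m n) (c : Fin m) :
    topSupporters P {c}ᶜ = lastCount P c := by
  simp [topSupporters, lastCount]

lemma last_of_forall_lt {k : ℕ} (σ : Fin (k + 1) ≃ Fin (k + 1)) (c : Fin (k + 1))
    (h : ∀ b, b ≠ c → σ b < σ c) : σ c = Fin.last k := by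
  by_contra hc
  have hne : σ.symm (Fin.last k) ≠ c := fun e => hc (by rw [← e, σ.apply_symm_apply])
  have := h _ hne
  rw [σ.apply_symm_apply] at this
  exact absurd this (not_lt.mpr (Fin.le_last _))

lemma mul_lastCount_le_rankSum {k n : ℕ} (P : Profile (k + 1) n) (c : Fin (k + 1)) :
    k * lastCount P c ≤ rankSum P c := by
  unfold lastCount rankSum
  rw [mul_comm, ← smul_eq_mul, ← Finset.sum_const]
  refine le_trans (Finset.sum_le_sum fun i hi => ?_)
    (Finset.sum_le_sum_of_subset (Finset.filter_subset _ _))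
  rw [last_of_forall_lt (P i) c (Finset.mem_filter.mp hi).2, Fin.val_last]

lemma firstCount_add_lastCount_le {k n : ℕ} (hk : 1 ≤ k) (P : Profile (k + 1) n)
    (c : Fin (k + 1)) : firstCount P c + lastCount P c ≤ n := by
  have : Nontrivial (Fin (k + 1)) := Fin.nontrivial_iff_two_le.mpr (by omega)
  obtain ⟨b, hb⟩ := exists_ne c
  unfold firstCount lastCount
  rw [← Finset.card_union_of_disjoint]
  · simpa using Finset.card_le_univ (α := Fin n) _
  · rw [Finset.disjoint_filter]
    exact fun i _ h h' => lt_asymm (h b hb) (h' b hb)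

lemma notMem_cmWinners_of_lastCount {k n : ℕ} (hk : 1 ≤ k) (hn : 1 ≤ n)
    (P : Profile (k + 1) n) (c : Fin (k + 1)) (h : n < 2 * lastCount P c) :
    c ∉ cmWinners P := by
  intro hc
  unfold cmWinners at hc
  split_ifs at hc with hex
  · have hf := (Finset.mem_filter.mp hc).2
    have hf' : n < 2 * firstCount P c := by
      have : (n : ℝ) < 2 * firstCount P c := by linarith
      exact_mod_cast this
    have := firstCount_add_lastCount_le hk P c
    omega
  · have hmin := (Finset.mem_filter.mp hc).2
    have hn0 : (0 : ℝ) < n := by exact_mod_cast hn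
    have hR : k * n < 2 * rankSum P c := by
      have := mul_lastCount_le_rankSum P c
      nlinarith
    have hscore : (k : ℝ) < cmScore P c := by
      rw [cmScore_eq_of_le hk hn P c hR.le, lt_div_iff₀ hn0]
      exact_mod_cast hR
    have hsum : ∑ _a : Fin (k + 1), k * n < ∑ a, 2 * rankSum P a :=
      Finset.sum_lt_sum_of_nonempty Finset.univ_nonempty fun a _ =>
        lt_rankSum_of_lt_cmScore hk hn P a (hscore.trans_le (hmin a))
    have htotal := sum_rankSum_mul_two P
    rw [Finset.sum_const, Finset.card_univ, Fintype.card_fin, smul_eq_mul,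
      ← Finset.mul_sum] at hsum
    nlinarith

/-- Two voters with opposite rankings. -/
def oppositeProfile (m : ℕ) : Profile m 2 :=
  ![Equiv.refl _, Fin.revPerm]

lemma rankSum_oppositeProfile (k : ℕ) (a : Fin (k + 1)) :
    rankSum (oppositeProfile (k + 1)) a = k := by
  have := a.isLt
  simp [rankSum, oppositeProfile, Fin.sum_univ_two, Fin.val_rev]
  omega

lemma firstCount_oppositeProfile_le {k : ℕ} (hk : 1 ≤ k) (a : Fin (k + 1)) :
    firstCount (oppositeProfile (k + 1)) a ≤ 1 := by
  have : Nontrivial (Fin (k + 1)) := Fin.nontrivial_iff_two_le.mpr (by omega)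
  obtain ⟨b, hb⟩ := exists_ne a
  refine Finset.card_le_one.mpr fun i hi j hj => ?_
  have hi' := (Finset.mem_filter.mp hi).2 b hb
  have hj' := (Finset.mem_filter.mp hj).2 b hb
  fin_cases i <;> fin_cases j <;> simp [oppositeProfile] at hi' hj' ⊢ <;>
    exact lt_asymm hi' hj'

lemma cmWinners_oppositeProfile {k : ℕ} (hk : 1 ≤ k) :
    cmWinners (oppositeProfile (k + 1)) = Finset.univ := by
  have hscore : ∀ a, cmScore (oppositeProfile (k + 1)) a = k := fun a => by
    rw [cmScore_eq_of_le hk one_le_two _ a (by rw [rankSum_oppositeProfile]; omega),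
      rankSum_oppositeProfile]
    push_cast
    ring
  unfold cmWinners
  rw [if_neg]
  · simp [hscore]
  · rintro ⟨a, ha⟩
    norm_num at ha
    exact absurd ha (firstCount_oppositeProfile_le hk a).not_gt

lemma one_le_lastCount_oppositeProfile (k : ℕ) :
    1 ≤ lastCount (oppositeProfile (k + 1)) (Fin.last k) := by
  refine Finset.card_pos.mpr ⟨0, Finset.mem_filter.mpr ⟨Finset.mem_univ _, fun b hb => ?_⟩⟩
  simpa [oppositeProfile] using Fin.lt_last_iff_ne_last.mpr hb

/-- For all integers `k ≥ 1` and `m = k + 1`, and every real `q` with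
`0 < q < 1`, the convex median voting rule satisfies the `(q,k,m)`-majority
criterion iff `q ≥ 1/2`. -/
theorem cm_qkm_majority_top (m k : ℕ) (hk : 1 ≤ k) (hm : m = k + 1)
    (q : ℝ) (hq0 : 0 < q) (hq1 : q < 1) :
    MajorityCriterion m k q (fun n P => cmWinners P) ↔
      (1 : ℝ) / 2 ≤ q := by
  subst hm
  constructor
  · intro h
    by_contra! hq
    have hsub := h 2 one_le_two (oppositeProfile (k + 1)) {Fin.last k}ᶜ
      (by simp [Finset.card_compl]) ?_
    · simp only [cmWinners_oppositeProfile hk] at hsub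
      simpa using hsub (Finset.mem_univ (Fin.last k))
    · rw [topSupporters_compl_singleton]
      have : (1 : ℝ) ≤ lastCount (oppositeProfile (k + 1)) (Fin.last k) := by
        exact_mod_cast one_le_lastCount_oppositeProfile k
      push_cast
      linarith
  · intro hq n hn P B hB hsupp
    obtain ⟨c, hc⟩ : ∃ c, Bᶜ = {c} := by
      rw [← Finset.card_eq_one, Finset.card_compl, Fintype.card_fin, hB]
      omega
    obtain rfl : B = {c}ᶜ := by rw [← hc, compl_compl]
    rw [topSupporters_compl_singleton] at hsupp
    have hlast : n < 2 * lastCount P c := by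
      have hn0 : (0 : ℝ) ≤ n := n.cast_nonneg
      have : (n : ℝ) < 2 * lastCount P c := by nlinarith
      exact_mod_cast this
    intro a ha
    rw [Finset.mem_compl, Finset.mem_singleton]
    rintro rfl
    exact notMem_cmWinners_of_lastCount hk hn P a hlast ha

end Voting
end
end

section
/- For all integers m > k ≥ 1: if k is even (k ≥ 2) and q is a real number with 0 < q < (5k−2)/(8k), then Dodgson's rule fails the (q,k,m)-majority criterion; if k is odd and q is a real number with 0 < q < (5k²−2k+1)/(8k²), then Dodgson's rule fails the (q,k,m)-majority criterion. -/
open Finset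
open scoped Classical

noncomputable section

namespace Voting

variable {m n : ℕ}

/-- `a` is a Condorcet winner: `h(a,b) > n/2` for every `b ≠ a`. -/
def CondorcetWinner (P : Profile m n) (a : Fin m) : Prop :=
  ∀ b, b ≠ a → (n : ℝ) / 2 < (pairs P a b : ℝ)

/-- `Q` is obtained from `P` by one exchange of adjacent candidates in one
voter's preference order. -/
def AdjacentStep (P Q : Profile m n) : Prop :=
  ∃ i : Fin n, ∃ r s : Fin m, (r : ℕ) + 1 = (s : ℕ) ∧
    Q i = (P i).trans (Equiv.swap r s) ∧ ∀ j, j ≠ i → Q j = P j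

/-- `Q` is obtained from `P` by `s` sequential adjacent exchanges. -/
def Reachable (s : ℕ) (P Q : Profile m n) : Prop :=
  ∃ f : ℕ → Profile m n, f 0 = P ∧ f s = Q ∧ ∀ t < s, AdjacentStep (f t) (f (t + 1))

/-- The Dodgson score of `a`: the smallest number of sequential adjacent
exchanges after which `a` becomes a Condorcet winner. -/
def dodgsonScore (P : Profile m n) (a : Fin m) : ℕ :=
  sInf {s : ℕ | ∃ Q : Profile m n, Reachable s P Q ∧ CondorcetWinner Q a}

/-- Dodgson's rule: the winners are the candidates with the smallest Dodgson
score. -/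
def dodgsonWinners (P : Profile m n) : Finset (Fin m) :=
  Finset.univ.filter fun a => ∀ b, dodgsonScore P a ≤ dodgsonScore P b

theorem Reachable.trans {P Q R : Profile m n} {s t : ℕ} (hPQ : Reachable s P Q)
    (hQR : Reachable t Q R) : Reachable (s + t) P R := by
  obtain ⟨f, hf0, hfs, hf⟩ := hPQ
  obtain ⟨g, hg0, hgt, hg⟩ := hQR
  refine ⟨fun u => if u ≤ s then f u else g (u - s), by simp [hf0], ?_, fun u hu => ?_⟩
  · rcases Nat.eq_zero_or_pos t with rfl | ht
    · simp [hfs, ← hg0, hgt]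
    · simp [Nat.not_le.mpr (Nat.lt_add_of_pos_right ht), hgt]
  · rcases lt_trichotomy u s with h | rfl | h
    · simpa [h.le, Nat.succ_le_of_lt h] using hf u h
    · have := hg 0 (by omega)
      simpa [hfs, ← hg0] using this
    · have := hg (u - s) (by omega)
      have h1 : u + 1 - s = u - s + 1 := by omega
      have h2 : ¬ u ≤ s := by omega
      have h3 : ¬ u + 1 ≤ s := by omega
      simpa [h1, h2, h3] using this

/-- Raising `a` to the top of one voter's ranking costs as many exchanges as there are
candidates above `a`. -/
theorem exists_reachable_top_of_voter (i : Fin n) (a : Fin m) (r : ℕ) (P : Profile m n)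
    (hr : (P i a : ℕ) = r) :
    ∃ Q, Reachable r P Q ∧ (Q i a : ℕ) = 0 ∧ ∀ j, j ≠ i → Q j = P j := by
  induction r generalizing P with
  | zero => exact ⟨P, ⟨fun _ => P, rfl, rfl, by simp⟩, hr, fun _ _ => rfl⟩
  | succ r ih =>
    have hrm : r < m := by have := (P i a).isLt; omega
    let P' : Profile m n := Function.update P i ((P i).trans (Equiv.swap ⟨r, hrm⟩ (P i a)))
    have hstep : AdjacentStep P P' :=
      ⟨i, ⟨r, hrm⟩, P i a, hr.symm, by simp [P'], fun j hj => by simp [P', hj]⟩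
    obtain ⟨Q, hQ, hQi, hQj⟩ := ih P' (by simp [P'])
    refine ⟨Q, ?_, hQi, fun j hj => by rw [hQj j hj]; simp [P', hj]⟩
    have h1 : Reachable 1 P P' := by
      refine ⟨fun u => if u = 0 then P else P', by simp, by simp, fun t ht => ?_⟩
      obtain rfl : t = 0 := by omega
      simpa using hstep
    rw [Nat.add_comm]
    exact h1.trans hQ

theorem exists_reachable_top (P : Profile m n) (a : Fin m) (T : Finset (Fin n)) :
    ∃ Q, Reachable (∑ i ∈ T, (P i a : ℕ)) P Q ∧ (∀ i ∈ T, (Q i a : ℕ) = 0) ∧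
      ∀ i ∉ T, Q i = P i := by
  induction T using Finset.induction_on with
  | empty => exact ⟨P, ⟨fun _ => P, rfl, rfl, by simp⟩, by simp, fun _ _ => rfl⟩
  | insert i T hi ih =>
    obtain ⟨Q, hQ, hQT, hQP⟩ := ih
    obtain ⟨R, hR, hRi, hRj⟩ := exists_reachable_top_of_voter i a _ Q rfl
    refine ⟨R, ?_, fun j hj => ?_, fun j hj => ?_⟩
    · rw [Finset.sum_insert hi, Nat.add_comm, ← hQP i hi]
      exact hQ.trans hR
    · by_cases h : j = i
      · rw [h, hRi]
      · rw [hRj j h, hQT j ((Finset.mem_insert.mp hj).resolve_left h)]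
    · rw [Finset.mem_insert, not_or] at hj
      rw [hRj j hj.1, hQP j hj.2]

theorem card_top_le_pairs (P : Profile m n) (a b : Fin m) (hb : b ≠ a) :
    (Finset.univ.filter fun i => (P i a : ℕ) = 0).card ≤ pairs P a b := by
  refine Finset.card_le_card fun i hi => ?_
  simp only [Finset.mem_filter, Finset.mem_univ, true_and] at hi ⊢
  have h : (P i b : ℕ) ≠ 0 := fun h => hb ((P i).injective (Fin.ext (h.trans hi.symm)))
  rw [Fin.lt_def]
  omega

theorem exists_reachable_condorcetWinner (hn : 1 ≤ n) (P : Profile m n) (a : Fin m) :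
    ∃ s Q, Reachable s P Q ∧ CondorcetWinner Q a := by
  obtain ⟨Q, hQ, hQa, -⟩ := exists_reachable_top P a Finset.univ
  refine ⟨_, Q, hQ, fun b hb => ?_⟩
  have h := card_top_le_pairs Q a b hb
  rw [Finset.filter_true_of_mem hQa, Finset.card_univ, Fintype.card_fin] at h
  have h' : (n : ℝ) ≤ pairs Q a b := by exact_mod_cast h
  have hn' : (1 : ℝ) ≤ n := by exact_mod_cast hn
  linarith

/-- One adjacent exchange lets `b` overtake at most one candidate. -/
theorem AdjacentStep.sum_card_le {P Q : Profile m n} (h : AdjacentStep P Q) (b : Fin m)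
    (S : Finset (Fin m)) :
    ∑ i, (S.filter fun c => Q i b < Q i c).card ≤
      ∑ i, (S.filter fun c => P i b < P i c).card + 1 := by
  obtain ⟨i, r, s, hrs, hQ, hQj⟩ := h
  rw [← Finset.add_sum_erase _ _ (Finset.mem_univ i), ← Finset.add_sum_erase _ _ (Finset.mem_univ i)]
  have h1 : ∑ j ∈ Finset.univ.erase i, (S.filter fun c => Q j b < Q j c).card =
      ∑ j ∈ Finset.univ.erase i, (S.filter fun c => P j b < P j c).card :=
    Finset.sum_congr rfl fun j hj => by rw [hQj j (Finset.ne_of_mem_erase hj)]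
  have h2 : (S.filter fun c => Q i b < Q i c).card ≤
      (S.filter fun c => P i b < P i c).card + 1 := by
    refine (Finset.card_le_card ?_).trans (Finset.card_insert_le ((P i).symm r) _)
    intro c hc
    simp only [Finset.mem_filter, Finset.mem_insert] at hc ⊢
    obtain ⟨hcS, hc⟩ := hc
    by_cases hcr : c = (P i).symm r
    · exact Or.inl hcr
    · refine Or.inr ⟨hcS, ?_⟩
      have hcr' : P i c ≠ r := fun h => hcr (by rw [← h, Equiv.symm_apply_apply])
      rw [hQ] at hc
      simp only [Equiv.trans_apply, Equiv.swap_apply_def, if_neg hcr'] at hc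
      rw [Fin.lt_def] at hc ⊢
      rw [Ne, Fin.ext_iff] at hcr'
      split_ifs at hc <;> simp_all only [Fin.ext_iff] <;> omega
  omega

theorem Reachable.sum_card_le {P Q : Profile m n} {s : ℕ} (h : Reachable s P Q) (b : Fin m)
    (S : Finset (Fin m)) :
    ∑ i, (S.filter fun c => Q i b < Q i c).card ≤
      ∑ i, (S.filter fun c => P i b < P i c).card + s := by
  obtain ⟨f, rfl, rfl, hf⟩ := h
  have key : ∀ t ≤ s, ∑ i, (S.filter fun c => f t i b < f t i c).card ≤
      ∑ i, (S.filter fun c => f 0 i b < f 0 i c).card + t := by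
    intro t
    induction t with
    | zero => simp
    | succ t ih =>
      intro ht
      have h1 := ih (by omega)
      have h2 := (hf t (by omega)).sum_card_le b S
      omega
  exact key s le_rfl

theorem sum_card_filter_eq_sum_pairs (P : Profile m n) (b : Fin m) (S : Finset (Fin m)) :
    ∑ i, (S.filter fun c => P i b < P i c).card = ∑ c ∈ S, pairs P b c := by
  simp only [pairs, Finset.card_filter]
  exact Finset.sum_comm

/-- A lower bound for the Dodgson score: `b` must gain a majority against each member of `S`. -/
theorem card_mul_le_dodgsonScore {w : ℕ} (hn : 1 ≤ n) (hw : 2 * w ≤ n) (P : Profile m n)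
    (b : Fin m) (S : Finset (Fin m)) (hb : b ∉ S) :
    S.card * w ≤ ∑ i, (S.filter fun c => P i b < P i c).card + dodgsonScore P b := by
  obtain ⟨Q, hQ, hQb⟩ : ∃ Q, Reachable (dodgsonScore P b) P Q ∧ CondorcetWinner Q b :=
    Nat.sInf_mem (exists_reachable_condorcetWinner hn P b)
  refine le_trans ?_ (hQ.sum_card_le b S)
  rw [sum_card_filter_eq_sum_pairs, ← smul_eq_mul]
  refine Finset.card_nsmul_le_sum _ _ _ fun c hc => ?_
  have h1 := hQb c (fun h => hb (h ▸ hc))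
  have h2 : (2 * w : ℝ) ≤ n := by exact_mod_cast hw
  have h3 : (w : ℝ) < pairs Q b c := by linarith
  exact_mod_cast h3.le

/-- The rank of candidate `c` when the candidates below `k` are rotated by `i` and
candidate `k` comes just before or just after them. -/
def rotationRank (k : ℕ) (lead : Prop) (i c : ℕ) : ℕ :=
  if c < k then (c + i) % k + (if lead then 1 else 0)
  else if c = k then (if lead then 0 else k) else c

theorem rotationRank_lt {k : ℕ} (hk : 1 ≤ k) (hmk : k < m) (lead : Prop) (i c : ℕ) (hc : c < m) :
    rotationRank k lead i c < m := by
  have := Nat.mod_lt (c + i) hk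
  unfold rotationRank
  split_ifs <;> omega

theorem rotationRank_injective {k : ℕ} (hk : 1 ≤ k) (lead : Prop) (i c c' : ℕ)
    (h : rotationRank k lead i c = rotationRank k lead i c') : c = c' := by
  have h1 := Nat.mod_lt (c + i) hk
  have h2 := Nat.mod_lt (c' + i) hk
  have h3 : c < k → c' < k → (c + i) % k = (c' + i) % k → c = c' := fun hc hc' h =>
    Nat.ModEq.eq_of_lt_of_lt (Nat.ModEq.add_right_cancel' i h) hc hc'
  unfold rotationRank at h
  split_ifs at h <;> omega

def rotationRanking {k : ℕ} (hk : 1 ≤ k) (hmk : k < m) (lead : Prop) (i : ℕ) : Fin m ≃ Fin m :=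
  Equiv.ofBijective
    (fun c => ⟨rotationRank k lead i c, rotationRank_lt hk hmk lead i c c.isLt⟩)
    (Finite.injective_iff_bijective.mp fun c c' h =>
      Fin.ext (rotationRank_injective hk lead i c c' (Fin.ext_iff.mp h)))

/-- Voters rank the candidates below `k` in rotated orders; the first `y` voters put
candidate `k` just after them, the others put it first. -/
def rotationProfile {k : ℕ} (hk : 1 ≤ k) (hmk : k < m) (n y : ℕ) : Profile m n :=
  fun i => rotationRanking hk hmk (y ≤ (i : ℕ)) i

theorem rotationProfile_apply {k y : ℕ} (hk : 1 ≤ k) (hmk : k < m) (i : Fin n) (c : Fin m) :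
    (rotationProfile hk hmk n y i c : ℕ) = rotationRank k (y ≤ (i : ℕ)) i c := rfl

theorem sum_range_add_of_periodic {k : ℕ} {h : ℕ → ℕ} (hh : ∀ x, h (x + k) = h x) (b : ℕ) :
    ∑ r ∈ Finset.range k, h (b + r) = ∑ r ∈ Finset.range k, h r := by
  induction b with
  | zero => simp
  | succ b ih =>
    rw [← ih]
    have h1 := Finset.sum_range_succ (fun r => h (b + r)) k
    have h2 := Finset.sum_range_succ' (fun r => h (b + r)) k
    have h3 : ∀ r, b + 1 + r = b + (r + 1) := fun r => by omega
    simp only [h3]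
    simp only [hh, Nat.add_zero] at h1 h2
    omega

theorem sum_range_mul_add_of_periodic {k : ℕ} {h : ℕ → ℕ} (hh : ∀ x, h (x + k) = h x)
    (b N : ℕ) :
    ∑ r ∈ Finset.range (k * N), h (b + r) = N * ∑ r ∈ Finset.range k, h r := by
  induction N with
  | zero => simp
  | succ N ih =>
    rw [Nat.mul_succ, Finset.sum_range_add, ih, Nat.succ_mul]
    simp only [← Nat.add_assoc]
    rw [sum_range_add_of_periodic hh]

theorem two_mul_sum_range_tsub {k K : ℕ} (hK : K ≤ k) :
    2 * ∑ u ∈ Finset.range k, (K - u) = K * (K + 1) := by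
  induction k generalizing K with
  | zero => obtain rfl : K = 0 := by omega
            simp
  | succ k ih =>
    rw [Finset.sum_range_succ']
    rcases K with _ | K
    · simp
    · have := ih (K := K) (by omega)
      simp only [Nat.add_sub_add_right, Nat.sub_zero]
      linarith

/-- The candidate `j` places before `b` in the cyclic order of `0, …, k - 1`. -/
def cyclicPred {k : ℕ} (hmk : k < m) (b : Fin m) (j : ℕ) : Fin m :=
  ⟨if j ≤ (b : ℕ) then (b : ℕ) - j else (b : ℕ) + k - j, by split_ifs <;> omega⟩

theorem cyclicPred_injOn {k K : ℕ} (hmk : k < m) (b : Fin m) (hK : K < k) :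
    Set.InjOn (cyclicPred hmk b) (Finset.Icc 1 K : Finset ℕ) := by
  intro j hj j' hj' h
  rw [Finset.mem_coe, Finset.mem_Icc] at hj hj'
  rw [cyclicPred, cyclicPred, Fin.ext_iff] at h
  dsimp only at h
  split_ifs at h <;> omega

theorem lt_of_rotationProfile_lt_cyclicPred {k y j : ℕ} (hk : 1 ≤ k) (hmk : k < m) (i : Fin n)
    (b : Fin m) (hb : (b : ℕ) < k) (hj : j < k)
    (h : rotationProfile hk hmk n y i b < rotationProfile hk hmk n y i (cyclicPred hmk b j)) :
    ((b : ℕ) + i) % k < j := by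
  by_contra! hle
  obtain ⟨c, hc⟩ : ∃ c : ℕ, c = (cyclicPred hmk b j : ℕ) := ⟨_, rfl⟩
  have hck : c < k ∧ (c + j = b ∨ c + j = b + k) := by
    rw [hc, cyclicPred]
    dsimp only
    split_ifs <;> omega
  rw [Fin.lt_def, rotationProfile_apply, rotationProfile_apply, ← hc, rotationRank, rotationRank,
    if_pos hb, if_pos hck.1] at h
  have hlt := Nat.mod_lt ((b : ℕ) + i) hk
  have hdiv := Nat.div_add_mod ((b : ℕ) + i) k
  have hmod : (c + i) % k = ((b : ℕ) + i) % k - j := by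
    rcases hck.2 with h2 | h2
    · rw [show c + i = k * (((b : ℕ) + i) / k) + (((b : ℕ) + i) % k - j) by omega,
        Nat.mul_add_mod, Nat.mod_eq_of_lt (by omega)]
    · rw [show c + i = k * (((b : ℕ) + i) / k + 1) + (((b : ℕ) + i) % k - j) by
          rw [Nat.mul_succ]; omega,
        Nat.mul_add_mod, Nat.mod_eq_of_lt (by omega)]
  omega

/-- In a rotation profile every candidate below `k` has a large Dodgson score. -/
theorem le_dodgsonScore_rotationProfile {k K M y : ℕ} (hk : 1 ≤ k) (hmk : k < m) (hK : K < k)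
    (hM : 1 ≤ M) (b : Fin m) (hb : (b : ℕ) < k) :
    M * (K * (k - K - 1)) ≤
      dodgsonScore (rotationProfile hk hmk (k * (2 * M)) y) b := by
  set P := rotationProfile hk hmk (k * (2 * M)) y
  set S := (Finset.Icc 1 K).image (cyclicPred hmk b) with hS
  have hcard : S.card = K := by
    rw [hS, Finset.card_image_of_injOn (cyclicPred_injOn hmk b hK), Nat.card_Icc]
    omega
  have hbS : b ∉ S := by
    rw [hS, Finset.mem_image]
    rintro ⟨j, hj, h⟩
    rw [Finset.mem_Icc] at hj
    rw [cyclicPred, Fin.ext_iff] at h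
    dsimp only at h
    split_ifs at h <;> omega
  have hvoter : ∀ i, (S.filter fun c => P i b < P i c).card ≤ K - ((b : ℕ) + i) % k := by
    intro i
    rw [← Nat.card_Ioc]
    refine (Finset.card_le_card (t := (Finset.Ioc (((b : ℕ) + i) % k) K).image
      (cyclicPred hmk b)) fun c hc => ?_).trans Finset.card_image_le
    rw [Finset.mem_filter, hS, Finset.mem_image] at hc
    obtain ⟨⟨j, hj, rfl⟩, hc⟩ := hc
    rw [Finset.mem_Icc] at hj
    exact Finset.mem_image_of_mem _ (Finset.mem_Ioc.mpr
      ⟨lt_of_rotationProfile_lt_cyclicPred hk hmk i b hb (by omega) hc, hj.2⟩)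
  have hsum : ∑ i, (S.filter fun c => P i b < P i c).card ≤ M * (K * (K + 1)) := by
    refine (Finset.sum_le_sum fun i _ => hvoter i).trans (le_of_eq ?_)
    rw [Fin.sum_univ_eq_sum_range (fun i => K - ((b : ℕ) + i) % k),
      sum_range_mul_add_of_periodic (h := fun x => K - x % k) (by simp),
      ← two_mul_sum_range_tsub hK.le, Finset.sum_congr rfl fun u hu => by
        rw [Nat.mod_eq_of_lt (Finset.mem_range.mp hu)]]
    ring
  have hlow := card_mul_le_dodgsonScore (w := k * M) (Nat.mul_pos hk (by omega))
    (by rw [Nat.mul_left_comm]) P b S hbS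
  rw [hcard] at hlow
  obtain ⟨e, rfl⟩ : ∃ e, k = K + 1 + e := Nat.exists_eq_add_of_le hK
  rw [show K + 1 + e - K - 1 = e by omega]
  nlinarith

/-- Raising candidate `k` to the top for `t` voters makes it a Condorcet winner. -/
theorem dodgsonScore_rotationProfile_le {k y t : ℕ} (hk : 1 ≤ k) (hmk : k < m) (hty : t ≤ y)
    (hyn : y ≤ n) (h : n < 2 * (t + (n - y))) :
    dodgsonScore (rotationProfile hk hmk n y) ⟨k, hmk⟩ ≤ k * t := by
  set P := rotationProfile hk hmk n y with hP
  set T : Finset (Fin n) := Finset.univ.filter fun i => (i : ℕ) < t with hT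
  have hPT : ∀ i ∈ T, (P i ⟨k, hmk⟩ : ℕ) = k := by
    intro i hi
    rw [hT, Finset.mem_filter] at hi
    rw [hP, rotationProfile_apply, rotationRank]
    simp only [lt_irrefl, if_false, if_true]
    rw [if_neg (by omega)]
  have hTcard : T.card = t := by
    rw [hT, Fin.card_filter_val_lt]
    omega
  obtain ⟨Q, hQ, hQT, hQP⟩ := exists_reachable_top P ⟨k, hmk⟩ T
  rw [Finset.sum_congr rfl hPT, Finset.sum_const, hTcard, smul_eq_mul, Nat.mul_comm] at hQ
  refine Nat.sInf_le ⟨Q, hQ, fun b hb => ?_⟩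
  have htop : t + (n - y) ≤ pairs Q ⟨k, hmk⟩ b := by
    refine le_trans ?_ (card_top_le_pairs Q ⟨k, hmk⟩ b hb)
    have hU : (Finset.univ.filter fun i : Fin n => ¬ (i : ℕ) < y).card = n - y := by
      rw [Finset.filter_not, Finset.card_sdiff_of_subset (Finset.filter_subset _ _),
        Fin.card_filter_val_lt, Finset.card_univ, Fintype.card_fin]
      omega
    rw [← hTcard, ← hU, ← Finset.card_union_of_disjoint]
    · refine Finset.card_le_card fun i hi => ?_
      rw [Finset.mem_filter]
      refine ⟨Finset.mem_univ i, ?_⟩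
      by_cases hiT : i ∈ T
      · exact hQT i hiT
      · have hiy := (Finset.mem_filter.mp ((Finset.mem_union.mp hi).resolve_left hiT)).2
        rw [hQP i hiT, hP, rotationProfile_apply, rotationRank]
        simp only [lt_irrefl, if_false, if_true]
        rw [if_pos (by omega)]
    · rw [Finset.disjoint_left]
      intro i hi hi'
      have h1 := (Finset.mem_filter.mp hi).2
      have h2 := (Finset.mem_filter.mp hi').2
      omega
  have h1 : (n : ℝ) < 2 * pairs Q ⟨k, hmk⟩ b := by
    exact_mod_cast h.trans_le (Nat.mul_le_mul_left 2 htop)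
  linarith

theorem le_topSupporters_rotationProfile {k y : ℕ} (hk : 1 ≤ k) (hmk : k < m) (hyn : y ≤ n) :
    y ≤ topSupporters (rotationProfile hk hmk n y)
      (Finset.univ.filter fun c : Fin m => (c : ℕ) < k) := by
  have hy : (Finset.univ.filter fun i : Fin n => (i : ℕ) < y).card = y := by
    rw [Fin.card_filter_val_lt]
    omega
  conv_lhs => rw [← hy]
  refine Finset.card_le_card fun i hi => ?_
  rw [Finset.mem_filter] at hi ⊢
  refine ⟨hi.1, fun a ha b hb => ?_⟩
  simp only [Finset.mem_filter, Finset.mem_univ, true_and] at ha hb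
  have hlt := Nat.mod_lt ((a : ℕ) + i) hk
  rw [Fin.lt_def, rotationProfile_apply, rotationProfile_apply, rotationRank, rotationRank]
  split_ifs <;> omega

/-- If an outsider scores no worse than every member of `B`, some winner lies outside `B`. -/
theorem not_dodgsonWinners_subset (P : Profile m n) (B : Finset (Fin m)) (d : Fin m)
    (hd : d ∉ B) (h : ∀ b ∈ B, dodgsonScore P d ≤ dodgsonScore P b) :
    ¬ dodgsonWinners P ⊆ B := by
  intro hsub
  obtain ⟨c, hc, hmin⟩ := Finset.exists_min_image (Finset.univ \ B) (dodgsonScore P)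
    ⟨d, by simpa using hd⟩
  refine (Finset.mem_sdiff.mp hc).2 (hsub (Finset.mem_filter.mpr ⟨Finset.mem_univ c, fun b => ?_⟩))
  by_cases hb : b ∈ B
  · exact (hmin d (by simpa using hd)).trans (h b hb)
  · exact hmin b (by simpa using hb)

theorem not_majorityCriterion_dodgsonWinners {k K : ℕ} (hk : 1 ≤ k) (hmk : k < m) (hK : K < k)
    {q : ℝ} (hq : 2 * (k : ℝ) ^ 2 * q < (k : ℝ) ^ 2 + (K : ℝ) * ((k : ℝ) - K - 1)) :
    ¬ MajorityCriterion m k q (fun _ P => dodgsonWinners P) := by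
  obtain ⟨L, hL⟩ := exists_nat_gt
    (1 / ((k : ℝ) ^ 2 + (K : ℝ) * ((k : ℝ) - K - 1) - 2 * (k : ℝ) ^ 2 * q))
  have hgap := sub_pos.mpr hq
  have hL0 : 1 ≤ L := by
    have : (0 : ℝ) < L := (one_div_pos.mpr hgap).trans hL
    exact_mod_cast this
  rw [div_lt_iff₀ hgap] at hL
  set E := K * (k - K - 1) with hE
  have hER : (E : ℝ) = (K : ℝ) * ((k : ℝ) - K - 1) := by
    rw [hE, Nat.sub_sub, Nat.cast_mul, Nat.cast_sub (by omega)]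
    push_cast
    ring
  have hEk : E ≤ k * k := Nat.mul_le_mul hK.le (by omega)
  have hLE : L * E ≤ L * (k * k) := Nat.mul_le_mul_left L hEk
  have hLk : 1 ≤ L * (k * k) := Nat.mul_pos hL0 (Nat.mul_pos hk hk)
  have hn : k * (2 * (k * L)) = 2 * (L * (k * k)) := by ring
  set y := L * (k * k) + L * E - 1 with hy
  have hyn : y ≤ k * (2 * (k * L)) := by omega
  intro hmaj
  have hBcard : (Finset.univ.filter fun c : Fin m => (c : ℕ) < k).card = k := by
    rw [Fin.card_filter_val_lt]
    omega
  refine not_dodgsonWinners_subset (rotationProfile hk hmk (k * (2 * (k * L))) y)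
    (Finset.univ.filter fun c : Fin m => (c : ℕ) < k) ⟨k, hmk⟩ (by simp) (fun b hb => ?_)
    (hmaj _ (by omega) _ _ hBcard ?_)
  · have h1 := dodgsonScore_rotationProfile_le (t := L * E) hk hmk (by omega : L * E ≤ y) hyn
      (by omega)
    have h2 := le_dodgsonScore_rotationProfile (M := k * L) (y := y) hk hmk hK
      (Nat.mul_pos hk hL0) b (Finset.mem_filter.mp hb).2
    refine h1.trans (le_of_eq_of_le ?_ h2)
    rw [← hE]
    ring
  · refine lt_of_lt_of_le ?_
      (Nat.cast_le.mpr (le_topSupporters_rotationProfile (y := y) hk hmk hyn))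
    rw [hn, hy, Nat.cast_sub (by omega)]
    push_cast
    rw [hER]
    nlinarith

/-- For all integers `m > k ≥ 1`: if `k` is even (`k ≥ 2`) and
`0 < q < (5k−2)/(8k)`, then Dodgson's rule fails the `(q,k,m)`-majority
criterion; if `k` is odd and `0 < q < (5k²−2k+1)/(8k²)`, then Dodgson's rule
fails the `(q,k,m)`-majority criterion. -/
theorem dodgson_qkm_majority_fails (m k : ℕ) (hk : 1 ≤ k) (hmk : k < m) (q : ℝ)
    (hq0 : 0 < q) :
    (k % 2 = 0 → 2 ≤ k → q < (5 * (k : ℝ) - 2) / (8 * (k : ℝ)) →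
      ¬ MajorityCriterion m k q (fun n P => dodgsonWinners P)) ∧
    (k % 2 = 1 → q < (5 * (k : ℝ) ^ 2 - 2 * (k : ℝ) + 1) / (8 * (k : ℝ) ^ 2) →
      ¬ MajorityCriterion m k q (fun n P => dodgsonWinners P)) := by
  have hk0 : (0 : ℝ) < k := by exact_mod_cast hk
  refine ⟨fun heven _ hq => ?_, fun hodd hq => ?_⟩
  · refine not_majorityCriterion_dodgsonWinners (K := k / 2) hk hmk (by omega) ?_
    have hK : (k : ℝ) = 2 * ((k / 2 : ℕ) : ℝ) := by
      exact_mod_cast (by omega : k = 2 * (k / 2))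
    rw [lt_div_iff₀ (by positivity)] at hq
    generalize ((k / 2 : ℕ) : ℝ) = K at hK
    obtain rfl : K = k / 2 := by linarith
    nlinarith
  · refine not_majorityCriterion_dodgsonWinners (K := k / 2) hk hmk (by omega) ?_
    have hK : (k : ℝ) = 2 * ((k / 2 : ℕ) : ℝ) + 1 := by
      exact_mod_cast (by omega : k = 2 * (k / 2) + 1)
    rw [lt_div_iff₀ (by positivity)] at hq
    generalize ((k / 2 : ℕ) : ℝ) = K at hK
    obtain rfl : K = (k - 1) / 2 := by linarith
    nlinarith

end Voting
end
end

section
/- For all integers m > k ≥ 1 and every real number q with 0 < q < 1: if q ≥ (m−k)/m, then the proportional veto core satisfies the (q,k,m)-majority criterion; and if q < (m−k)/m, then there exist an n ≥ 1, a preference profile with m candidates, and a k-element set B of candidates such that strictly more than q·n voters give B the top k positions yet every candidate of B is blocked (so no candidate of B belongs to the proportional veto core, and the criterion fails). -/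
open Finset
open scoped Classical

noncomputable section

namespace Voting

variable {m n : ℕ}

/-- Candidate `a` is blocked: some coalition of `t` voters and nonempty set `D`
of candidates with `a ∉ D` are such that each of the `t` voters prefers every
candidate of `D` to `a`, and `|A \ D| < m·t/n`. -/
def Blocked (P : Profile m n) (a : Fin m) : Prop :=
  ∃ (T : Finset (Fin n)) (D : Finset (Fin m)), D.Nonempty ∧ a ∉ D ∧
    (∀ i ∈ T, ∀ d ∈ D, P i d < P i a) ∧
    ((m : ℝ) - (D.card : ℝ)) < (m : ℝ) * (T.card : ℝ) / (n : ℝ)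

/-- The proportional veto core: all candidates that are not blocked. -/
def vetoCoreWinners (P : Profile m n) : Finset (Fin m) :=
  Finset.univ.filter fun a => ¬ Blocked P a

/-- For all integers `m > k ≥ 1` and every real `0 < q < 1`: if
`q ≥ (m−k)/m` then the proportional veto core satisfies the `(q,k,m)`-majority
criterion; and if `q < (m−k)/m` then there are `n ≥ 1`, a profile and a
`k`-element set `B` such that strictly more than `q·n` voters give `B` the top
`k` positions yet every candidate of `B` is blocked. -/
theorem veto_core_qkm_majority (m k : ℕ) (hk : 1 ≤ k) (hmk : k < m)
    (q : ℝ) (hq0 : 0 < q) (hq1 : q < 1) :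
    (((m : ℝ) - (k : ℝ)) / (m : ℝ) ≤ q →
      MajorityCriterion m k q (fun n P => vetoCoreWinners P)) ∧
    (q < ((m : ℝ) - (k : ℝ)) / (m : ℝ) →
      ∃ n : ℕ, 1 ≤ n ∧ ∃ P : Profile m n, ∃ B : Finset (Fin m),
        B.card = k ∧ q * (n : ℝ) < (topSupporters P B : ℝ) ∧
        ∀ b ∈ B, Blocked P b) := by
  have hm : (0 : ℝ) < m := by exact_mod_cast (by omega : 0 < m)
  refine ⟨fun hq n hn P B hB hT a ha => ?_, fun hq => ?_⟩
  · by_contra haB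
    have hn' : (0 : ℝ) < n := by exact_mod_cast hn
    refine (Finset.mem_filter.mp ha).2
      ⟨Finset.univ.filter fun i => ∀ a ∈ B, ∀ b ∉ B, P i a < P i b, B,
        Finset.card_pos.mp (by omega), haB,
        fun i hi d hd => (Finset.mem_filter.mp hi).2 d hd a haB, ?_⟩
    rw [div_le_iff₀ hm] at hq
    rw [lt_div_iff₀ hn', hB]
    calc ((m : ℝ) - k) * n ≤ q * m * n := by gcongr
      _ = m * (q * n) := by ring
      _ < _ := by gcongr; exact hT
  · obtain ⟨r, hqr, hr⟩ := exists_rat_btwn hq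
    have hden : (0 : ℝ) < r.den := by exact_mod_cast r.den_pos
    have hrpos : 0 < r := by exact_mod_cast hq0.trans hqr
    obtain ⟨s, hs⟩ := Int.eq_ofNat_of_zero_le (Rat.num_nonneg.mpr hrpos.le)
    have hrs : (r : ℝ) = s / r.den := by
      rw [Rat.cast_def, hs]; simp
    rw [hrs, lt_div_iff₀ hden] at hqr
    rw [hrs, div_lt_div_iff₀ hden hm] at hr
    have hsn : s ≤ r.den := by
      have : (s : ℝ) * m ≤ r.den * m := by
        have : (0 : ℝ) ≤ k * r.den := by positivity
        linarith
      exact_mod_cast le_of_mul_le_mul_right this hm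
    have hcard : (Finset.univ.filter fun i : Fin r.den => (i : ℕ) < s).card = s := by
      rw [Fin.card_filter_val_lt, min_eq_right hsn]
    have hB : (Finset.Iio (⟨k, hmk⟩ : Fin m)).card = k := by simp
    refine ⟨r.den, r.den_pos,
      fun i => if (i : ℕ) < s then Equiv.refl _ else Fin.revPerm,
      Finset.Iio ⟨k, hmk⟩, hB, hqr.trans_le ?_, fun b hb => ?_⟩
    · rw [Nat.cast_le]
      refine hcard.symm.le.trans (Finset.card_le_card fun i hi => ?_)
      have hi' : (i : ℕ) < s := by simpa using hi
      simp only [Finset.mem_filter, Finset.mem_univ, true_and, if_pos hi', Equiv.refl_apply]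
      intro a ha c hc
      exact (Finset.mem_Iio.mp ha).trans_le (by simpa using hc)
    · refine ⟨(Finset.univ.filter fun i : Fin r.den => (i : ℕ) < s)ᶜ,
        (Finset.Iio ⟨k, hmk⟩)ᶜ, ⟨⟨k, hmk⟩, by simp⟩, by simpa using hb, fun i hi d hd => ?_, ?_⟩
      · have hi' : ¬ (i : ℕ) < s := by simpa using hi
        have hd' : (⟨k, hmk⟩ : Fin m) ≤ d := by simpa using hd
        simp only [if_neg hi', Fin.revPerm_apply, Fin.rev_lt_rev]
        exact (Finset.mem_Iio.mp hb).trans_le hd'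
      · rw [Finset.card_compl, Finset.card_compl, hcard, hB, Fintype.card_fin, Fintype.card_fin,
          Nat.cast_sub hmk.le, Nat.cast_sub hsn, lt_div_iff₀ hden]
        linarith

end Voting
end
end
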